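/- Let H be a real symmetric d×d matrix with ‖H‖₂ ≤ L1 (L1 > 0), and set M = I − H/L1 (so M is symmetric positive semidefinite with eigenvalues in [0, 2]). Let δ, ε ≥ 0 with δ + ε ≤ 1, and let v be a unit vector satisfying vᵀMv ≥ (1 − δ)·(1 − ε)·λ_max(M). Then λ_min(H) ≥ vᵀHv − 2·L1·(δ + ε). -/

import Mathlib

open scoped RealInnerProductSpace

lemma abs_inner_apply_self_le_of_opNorm_le {E : Type*} [NormedAddCommGroup E]
    [InnerProductSpace ℝ E] {T : E →L[ℝ] E} {C : ℝ} (hT : ‖T‖ ≤ C) {u : E} (hu : ‖u‖ = 1) :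
    |⟪T u, u⟫| ≤ C :=
  calc |⟪T u, u⟫| ≤ ‖T u‖ * ‖u‖ := abs_real_inner_le_norm _ _
    _ ≤ ‖T‖ := by simpa [hu] using T.le_opNorm u
    _ ≤ C := hT

lemma bddAbove_range_inner_apply_self {E : Type*} [NormedAddCommGroup E]
    [InnerProductSpace ℝ E] (T : E →L[ℝ] E) :
    BddAbove (Set.range fun u : {u : E // ‖u‖ = 1} ↦ ⟪T u.1, u.1⟫) := by
  refine ⟨‖T‖, ?_⟩
  rintro _ ⟨u, rfl⟩
  exact (le_abs_self _).trans (abs_inner_apply_self_le_of_opNorm_le le_rfl u.2)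

/-- Lemma on approximate PCA: if a unit vector `v` approximately maximizes
the quadratic form of `M = I - H/L1`, then `v` approximately minimizes the quadratic form
of `H`, i.e. `λ_min(H) ≥ vᵀHv - 2·L1·(δ + ε)`. -/
theorem approx_pca_smallest_eigenvalue {d : ℕ} (hd : 0 < d) (L1 δ ε : ℝ)
    (hL1 : 0 < L1)
    (H : EuclideanSpace ℝ (Fin d) →L[ℝ] EuclideanSpace ℝ (Fin d))
    (hHsym : ∀ u w : EuclideanSpace ℝ (Fin d), ⟪H u, w⟫ = ⟪u, H w⟫)
    (hHnorm : ‖H‖ ≤ L1)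
    (hδ : 0 ≤ δ) (hε : 0 ≤ ε) (hδε : δ + ε ≤ 1)
    (M : EuclideanSpace ℝ (Fin d) →L[ℝ] EuclideanSpace ℝ (Fin d))
    (hM : M = ContinuousLinearMap.id ℝ (EuclideanSpace ℝ (Fin d)) - L1⁻¹ • H)
    (v : EuclideanSpace ℝ (Fin d)) (hv : ‖v‖ = 1)
    (hvM : ⟪M v, v⟫ ≥ (1 - δ) * (1 - ε) *
      ⨆ u : {u : EuclideanSpace ℝ (Fin d) // ‖u‖ = 1}, ⟪M u.1, u.1⟫) :
    ∀ u : EuclideanSpace ℝ (Fin d), ‖u‖ = 1 →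
      ⟪H u, u⟫ ≥ ⟪H v, v⟫ - 2 * L1 * (δ + ε) := by
  intro u hu
  have hquad : ∀ w : EuclideanSpace ℝ (Fin d), ‖w‖ = 1 → L1 * ⟪M w, w⟫ = L1 - ⟪H w, w⟫ := by
    intro w hw
    simp only [hM, sub_apply, smul_apply,
      ContinuousLinearMap.id_apply, inner_sub_left, real_inner_smul_left,
      real_inner_self_eq_norm_sq, hw]
    field_simp
  have hsup := le_ciSup (bddAbove_range_inner_apply_self M) ⟨u, hu⟩
  have hc : 0 ≤ (1 - δ) * (1 - ε) := mul_nonneg (by linarith) (by linarith)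
  have hvu : (1 - δ) * (1 - ε) * (L1 - ⟪H u, u⟫) ≤ L1 - ⟪H v, v⟫ := by
    rw [← hquad u hu, ← hquad v hv, mul_left_comm]
    gcongr
    exact (mul_le_mul_of_nonneg_left hsup hc).trans hvM
  obtain ⟨hlower, hupper⟩ := abs_le.mp (abs_inner_apply_self_le_of_opNorm_le hHnorm hu)
  have hgap : (1 - (1 - δ) * (1 - ε)) * (L1 - ⟪H u, u⟫) ≤ (δ + ε) * (2 * L1) :=
    mul_le_mul (by linarith [mul_nonneg hδ hε]) (by linarith) (by linarith) (by linarith)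
  linarith
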